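/- Let f ∈ ℤ[x] with positive leading coefficient of degree k ≥ 1, and let a₁, a₂ be nonzero integers. Then 𝔖(f,a₁,a₂) = ∏_{p prime} (1 + F(p)), where F(p) = (z_f(p) − 1)/(p − 1)² if p ∈ 𝒫₀, F(p) = (1 − z_f(p))/(p − 1) if p ∈ 𝒫₁, and F(p) = z_f(p) − 1 if p ∈ 𝒫₂. -/

import Mathlib

open Real Filter

open scoped Classical

/-- `zf f p` is the number of roots of `f` modulo `p`. -/
def zf (f : Polynomial ℤ) (p : ℕ) : ℕ :=
  ((Finset.range p).filter fun r : ℕ => f.eval (r : ℤ) % (p : ℤ) = 0).card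

/-- The complete exponential sum `S_{a/q} = Σ_{r=0}^{q−1} e^{2πi f(r) a/q}`. -/
noncomputable def Saq (f : Polynomial ℤ) (a : ℤ) (q : ℕ) : ℂ :=
  ∑ r ∈ Finset.range q,
    Complex.exp (2 * Real.pi * Complex.I * (f.eval (r : ℤ)) * a / q)

/-- The generalized singular series `𝔖(f,a₁,a₂)`, summed over `q ∈ ℕ₀`, `m₁ ∈ ℕ₁`,
`m₂ ∈ ℕ₂`, the squarefree numbers all of whose prime factors lie in `𝒫₀`, `𝒫₁`, `𝒫₂`
respectively. -/
noncomputable def SS2 (f : Polynomial ℤ) (a₁ a₂ : ℤ) : ℂ :=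
  ∑' q : {n : ℕ // Squarefree n ∧ ∀ p : ℕ, p.Prime → p ∣ n → ¬ ((p : ℤ) ∣ a₁ * a₂)},
  ∑' m₁ : {n : ℕ // Squarefree n ∧ ∀ p : ℕ, p.Prime → p ∣ n →
      ((p : ℤ) ∣ a₁ * a₂ ∧ (¬ ((p : ℤ) ∣ a₁) ∨ ¬ ((p : ℤ) ∣ a₂)))},
  ∑' m₂ : {n : ℕ // Squarefree n ∧ ∀ p : ℕ, p.Prime → p ∣ n →
      ((p : ℤ) ∣ a₁ ∧ (p : ℤ) ∣ a₂)},
    (((ArithmeticFunction.moebius (q : ℕ) : ℝ) ^ 2 *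
          (ArithmeticFunction.moebius (m₁ : ℕ) : ℝ) /
          ((Nat.totient (q : ℕ) : ℝ) ^ 2 * (Nat.totient (m₁ : ℕ) : ℝ)) *
        (1 / (((q : ℕ) : ℝ) * ((m₁ : ℕ) : ℝ) * ((m₂ : ℕ) : ℝ))) : ℝ) : ℂ) *
      ∑ a ∈ (Finset.range ((q : ℕ) * (m₁ : ℕ) * (m₂ : ℕ))).filter
          (fun a => Nat.Coprime a ((q : ℕ) * (m₁ : ℕ) * (m₂ : ℕ))),
        Saq f (a : ℤ) ((q : ℕ) * (m₁ : ℕ) * (m₂ : ℕ))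

/-- The local factor `F(p)` for the generalized singular series. -/
noncomputable def Floc (f : Polynomial ℤ) (a₁ a₂ : ℤ) (p : ℕ) : ℝ :=
  if (p : ℤ) ∣ a₁ ∧ (p : ℤ) ∣ a₂ then (zf f p : ℝ) - 1
  else if (p : ℤ) ∣ a₁ * a₂ then (1 - (zf f p : ℝ)) / ((p : ℝ) - 1)
  else ((zf f p : ℝ) - 1) / ((p : ℝ) - 1) ^ 2


lemma aux_exp_congr (x y a : ℤ) (d : ℕ) (hd : 0 < d) (h : (d : ℤ) ∣ x - y) :
    Complex.exp (2 * Real.pi * Complex.I * x * a / d) =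
    Complex.exp (2 * Real.pi * Complex.I * y * a / d) := by
  obtain ⟨c, hc⟩ := h
  have hx : x = y + d * c := by linarith
  rw [Complex.exp_eq_exp_iff_exists_int]
  refine ⟨c * a, ?_⟩
  have : (d : ℂ) ≠ 0 := by exact_mod_cast hd.ne'
  subst hx
  push_cast
  field_simp

lemma aux_sum_periodic (h : ℕ → ℂ) (d : ℕ) (hp : ∀ r, h (r + d) = h r) (g : ℕ) :
    ∑ r ∈ Finset.range (g * d), h r = g * ∑ r ∈ Finset.range d, h r := by
  have hp' : ∀ k r, h (k * d + r) = h r := by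
    intro k
    induction k with
    | zero => intro r; simp
    | succ k ih =>
      intro r
      rw [← ih r, ← hp (k * d + r)]
      congr 1
      ring
  induction g with
  | zero => simp
  | succ g ih =>
    rw [Nat.succ_mul, Finset.sum_range_add, ih]
    simp only [hp']
    push_cast
    ring

lemma aux_eval_dvd (f : Polynomial ℤ) (r d : ℕ) :
    (d : ℤ) ∣ f.eval ((r + d : ℕ) : ℤ) - f.eval (r : ℤ) := by
  have := Polynomial.sub_dvd_eval_sub ((r + d : ℕ) : ℤ) (r : ℤ) f
  simpa using this

lemma aux_Saq_scale (f : Polynomial ℤ) (b g d : ℕ) (hg : 0 < g) (hd : 0 < d) :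
    Saq f ((g * b : ℕ) : ℤ) (g * d) = g * Saq f (b : ℤ) d := by
  unfold Saq
  rw [← aux_sum_periodic _ d]
  · apply Finset.sum_congr rfl
    intro r _
    congr 1
    have : (d : ℂ) ≠ 0 := by exact_mod_cast hd.ne'
    have : (g : ℂ) ≠ 0 := by exact_mod_cast hg.ne'
    push_cast
    field_simp
  · intro r
    exact aux_exp_congr _ _ _ _ hd (aux_eval_dvd f r d)

lemma aux_sum_Saq (f : Polynomial ℤ) (n : ℕ) (hn : 0 < n) :
    ∑ a ∈ Finset.range n, Saq f (a : ℤ) n = n * zf f n := by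
  unfold Saq zf
  rw [Finset.sum_comm, Finset.card_filter]
  push_cast
  rw [Finset.mul_sum]
  apply Finset.sum_congr rfl
  intro r _
  have hn0 : (n : ℂ) ≠ 0 := by exact_mod_cast hn.ne'
  set m := f.eval (r : ℤ) with hm
  have e : ∀ a : ℕ, Complex.exp (2 * Real.pi * Complex.I * m * (a : ℂ) / n) =
      (Complex.exp (2 * Real.pi * Complex.I * m / n)) ^ a := by
    intro a
    rw [← Complex.exp_nat_mul]
    congr 1
    ring
  simp only [e]
  split_ifs with h
  · have : Complex.exp (2 * Real.pi * Complex.I * m / n) = 1 := by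
      obtain ⟨c, hc⟩ := Int.dvd_of_emod_eq_zero h
      rw [Complex.exp_eq_one_iff]
      refine ⟨c, ?_⟩
      rw [hc]
      push_cast
      field_simp
    simp [this]
  · rw [geom_sum_eq]
    · have : Complex.exp (2 * Real.pi * Complex.I * m / n) ^ n = 1 := by
        rw [← Complex.exp_nat_mul, Complex.exp_eq_one_iff]
        exact ⟨m, by field_simp⟩
      simp [this]
    · intro h1
      apply h
      rw [Complex.exp_eq_one_iff] at h1
      obtain ⟨c, hc⟩ := h1
      have hpi : (2 * Real.pi * Complex.I : ℂ) ≠ 0 := Complex.two_pi_I_ne_zero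
      have : (m : ℂ) = n * c := by
        field_simp at hc
        have h2 : (2 * Real.pi * Complex.I : ℂ) * m = (2 * Real.pi * Complex.I : ℂ) * (n * c) := by
          linear_combination (2 * Real.pi * Complex.I : ℂ) * hc
        exact mul_left_cancel₀ hpi h2
      have h3 : m = n * c := by exact_mod_cast this
      rw [h3]
      simp

/-- Reduced sum. -/
noncomputable def TT (f : Polynomial ℤ) (n : ℕ) : ℂ :=
  ∑ a ∈ (Finset.range n).filter (fun a => Nat.Coprime a n), Saq f (a : ℤ) n

lemma aux_TT_div (f : Polynomial ℤ) (n : ℕ) (hn : 0 < n) :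
    ∑ d ∈ n.divisors, TT f d / d = zf f n := by
  have h1 := aux_sum_Saq f n hn
  have hn0 : (n : ℂ) ≠ 0 := by exact_mod_cast hn.ne'
  have hmap : ∀ a ∈ Finset.range n, n.gcd a ∈ n.divisors := by
    intro a _
    rw [Nat.mem_divisors]
    exact ⟨Nat.gcd_dvd_left _ _, hn.ne'⟩
  rw [← Finset.sum_fiberwise_of_maps_to hmap] at h1
  have h2 : ∀ g ∈ n.divisors, ∑ a ∈ (Finset.range n).filter (fun a => n.gcd a = g),
      Saq f (a : ℤ) n = g * TT f (n / g) := by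
    intro g hg
    obtain ⟨d, rfl⟩ := (Nat.mem_divisors.1 hg).1
    have hg0 : 0 < g := Nat.pos_of_mul_pos_right hn
    have hd0 : 0 < d := Nat.pos_of_mul_pos_left hn
    rw [Nat.mul_div_cancel_left _ hg0]
    unfold TT
    rw [Finset.mul_sum]
    symm
    apply Finset.sum_bij (fun k _ => g * k)
    · simp only [Finset.mem_filter, Finset.mem_range, and_imp]
      refine fun a ha1 ha2 => ⟨by gcongr, ?_⟩
      rw [Nat.gcd_mul_left, Nat.gcd_comm, ha2, mul_one]
    · simp [hg0.ne']
    · simp only [Finset.mem_filter, Finset.mem_range, exists_prop, and_imp]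
      intro b hb1 hb2
      have : g ∣ b := by
        rw [← hb2]
        apply Nat.gcd_dvd_right
      rcases this with ⟨q, rfl⟩
      refine ⟨q, ⟨⟨Nat.lt_of_mul_lt_mul_left hb1, ?_⟩, rfl⟩⟩
      rw [Nat.gcd_mul_left, mul_eq_left₀ hg0.ne'] at hb2
      rw [Nat.Coprime, Nat.gcd_comm, hb2]
    · intro a _
      rw [aux_Saq_scale f a g d hg0 hd0]
  rw [Finset.sum_congr rfl h2, ← Nat.sum_div_divisors] at h1
  apply mul_left_cancel₀ hn0
  rw [← h1, Finset.mul_sum]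
  apply Finset.sum_congr rfl
  intro d hd
  obtain ⟨e, rfl⟩ := (Nat.mem_divisors.1 hd).1
  have hg0 : 0 < d := Nat.pos_of_mul_pos_right hn
  have hd0 : 0 < e := Nat.pos_of_mul_pos_left hn
  have : (d : ℂ) ≠ 0 := by exact_mod_cast hg0.ne'
  rw [Nat.mul_div_cancel_left _ hg0, Nat.mul_div_cancel _ hd0]
  push_cast
  field_simp

lemma aux_zf_zmod (f : Polynomial ℤ) (n : ℕ) [NeZero n] :
    zf f n = Nat.card {x : ZMod n // Polynomial.aeval x f = 0} := by
  have key : ∀ r : ℕ, f.eval (r : ℤ) % (n : ℤ) = 0 ↔ Polynomial.aeval (r : ZMod n) f = 0 := by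
    intro r
    rw [← Int.dvd_iff_emod_eq_zero, ← ZMod.intCast_zmod_eq_zero_iff_dvd]
    have : (r : ZMod n) = algebraMap ℤ (ZMod n) (r : ℤ) := by simp
    rw [this, Polynomial.aeval_algebraMap_apply]
    simp
  rw [Nat.card_eq_fintype_card, Fintype.card_subtype]
  unfold zf
  refine Finset.card_bij (fun (r : ℕ) _ => (r : ZMod n)) ?_ ?_ ?_
  · intro r hr
    simp only [Finset.mem_filter, Finset.mem_univ, true_and] at hr ⊢
    exact (key r).1 hr.2
  · intro a ha b hb hab
    simp only [Finset.mem_filter, Finset.mem_range] at ha hb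
    rw [ZMod.natCast_eq_natCast_iff'] at hab
    rwa [Nat.mod_eq_of_lt ha.1, Nat.mod_eq_of_lt hb.1] at hab
  · intro x hx
    simp only [Finset.mem_filter, Finset.mem_univ, true_and] at hx
    refine ⟨x.val, ?_, by simp⟩
    simp only [Finset.mem_filter, Finset.mem_range]
    exact ⟨ZMod.val_lt x, (key _).2 (by simpa using hx)⟩

lemma aux_zf_mul (f : Polynomial ℤ) (m n : ℕ) (hm : 0 < m) (hn : 0 < n) (h : m.Coprime n) :
    zf f (m * n) = zf f m * zf f n := by
  have : NeZero m := ⟨hm.ne'⟩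
  have : NeZero n := ⟨hn.ne'⟩
  rw [aux_zf_zmod, aux_zf_zmod, aux_zf_zmod, ← Nat.card_prod]
  let e := (ZMod.chineseRemainder h).toIntAlgEquiv
  have h1 : ∀ (x : ZMod m × ZMod n), Polynomial.aeval x f = 0 ↔
      Polynomial.aeval x.1 f = 0 ∧ Polynomial.aeval x.2 f = 0 := by
    intro x
    have a1 := Polynomial.aeval_algHom_apply (AlgHom.fst ℤ (ZMod m) (ZMod n)) x f
    have a2 := Polynomial.aeval_algHom_apply (AlgHom.snd ℤ (ZMod m) (ZMod n)) x f
    simp only [AlgHom.fst_apply, AlgHom.snd_apply] at a1 a2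
    rw [a1, a2, Prod.ext_iff]
    rfl
  have h2 : ∀ x : ZMod (m * n), Polynomial.aeval x f = 0 ↔ Polynomial.aeval (e x) f = 0 := by
    intro x
    have := Polynomial.aeval_algHom_apply (AlgHomClass.toAlgHom e) x f
    change Polynomial.aeval (e x) f = e _ at this
    rw [this]
    simp
  apply Nat.card_congr
  exact (e.toEquiv.subtypeEquiv (q := fun x => Polynomial.aeval x.1 f = 0 ∧ Polynomial.aeval x.2 f = 0)
    (fun x => (h2 x).trans (h1 _))).trans (Equiv.subtypeProdEquivProd
      (p := fun x : ZMod m => Polynomial.aeval x f = 0) (q := fun x : ZMod n => Polynomial.aeval x f = 0))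

lemma aux_zf_one (f : Polynomial ℤ) : zf f 1 = 1 := by
  simp [zf]

lemma aux_zf_sqf (f : Polynomial ℤ) (n : ℕ) (hn : Squarefree n) :
    zf f n = ∏ p ∈ n.primeFactors, zf f p := by
  induction n using Nat.recOnPosPrimePosCoprime with
  | zero => simp at hn
  | one => simp [aux_zf_one]
  | prime_pow p k hp hk =>
    have : k = 1 := by
      rcases (Nat.squarefree_pow_iff hp.ne_one hk.ne').1 hn with ⟨_, h⟩
      exact h
    subst this
    simp [hp.primeFactors]
  | coprime a b ha hb hab iha ihb =>
    rw [aux_zf_mul f a b (by omega) (by omega) hab, hab.primeFactors_mul,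
      Finset.prod_union hab.disjoint_primeFactors, iha (hn.of_mul_left), ihb (hn.of_mul_right)]

lemma aux_TT_sqf (f : Polynomial ℤ) (n : ℕ) (hn : Squarefree n) :
    TT f n / n = ∏ p ∈ n.primeFactors, ((zf f p : ℂ) - 1) := by
  induction n using Nat.strong_induction_on with
  | _ n ih =>
  have hn0 : n ≠ 0 := hn.ne_zero
  have h1 := aux_TT_div f n (Nat.pos_of_ne_zero hn0)
  have h2 : ∑ d ∈ n.divisors, ∏ p ∈ d.primeFactors, ((zf f p : ℂ) - 1) = zf f n := by
    rw [aux_zf_sqf f n hn]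
    have hm := ArithmeticFunction.IsMultiplicative.prodPrimeFactors (fun p => (zf f p : ℂ) - 1)
    have h3 := hm.prodPrimeFactors_one_add_of_squarefree hn
    push_cast
    rw [Finset.sum_congr rfl (g := fun d => ArithmeticFunction.prodPrimeFactors (fun p => (zf f p : ℂ) - 1) d), ← h3]
    · apply Finset.prod_congr rfl
      intro p hp
      have hp' := Nat.prime_of_mem_primeFactors hp
      rw [ArithmeticFunction.prodPrimeFactors_apply hp'.ne_zero, hp'.primeFactors]
      simp
    · intro d hd
      rw [ArithmeticFunction.prodPrimeFactors_apply (Nat.pos_of_mem_divisors hd).ne']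
  rw [← Nat.cons_self_properDivisors hn0, Finset.sum_cons] at h1 h2
  rw [← h2, Finset.sum_congr rfl] at h1
  · exact add_right_cancel h1
  · intro d hd
    have hd' := Nat.mem_properDivisors.1 hd
    exact ih d hd'.2 (hn.squarefree_of_dvd hd'.1)

lemma aux_tsum_prod (F : ℕ → ℝ) (P : ℕ → Prop)
    (hF : Summable fun p : Nat.Primes => ‖F p‖) :
    ∑' n : {n : ℕ // Squarefree n ∧ ∀ p : ℕ, p.Prime → p ∣ n → P p},
      ∏ p ∈ (n : ℕ).primeFactors, F p =
    ∏' p : Nat.Primes, (1 + if P p then F p else 0) := by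
  have hs : Summable fun p : Nat.Primes => ‖(if P p then F p else 0 : ℝ)‖ := by
    refine hF.of_nonneg_of_le (fun _ => norm_nonneg _) (fun p => ?_)
    split_ifs <;> simp
  rw [tprod_one_add (summable_finsetProd_of_summable_norm hs)]
  let g : {n : ℕ // Squarefree n ∧ ∀ p : ℕ, p.Prime → p ∣ n → P p} → Finset Nat.Primes :=
    fun n => (n : ℕ).primeFactors.subtype Nat.Prime
  have hg : Function.Injective g := by
    intro m n h
    have h1 : (m : ℕ).primeFactors = (n : ℕ).primeFactors := by
      ext p
      constructor
      · intro hp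
        have hp' := Nat.prime_of_mem_primeFactors hp
        have : (⟨p, hp'⟩ : Nat.Primes) ∈ g m := Finset.mem_subtype.2 hp
        rw [h] at this
        exact Finset.mem_subtype.1 this
      · intro hp
        have hp' := Nat.prime_of_mem_primeFactors hp
        have : (⟨p, hp'⟩ : Nat.Primes) ∈ g n := Finset.mem_subtype.2 hp
        rw [← h] at this
        exact Finset.mem_subtype.1 this
    apply Subtype.ext
    rw [← Nat.prod_primeFactors_of_squarefree m.2.1, h1,
      Nat.prod_primeFactors_of_squarefree n.2.1]
  rw [← hg.tsum_eq]
  · apply tsum_congr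
    intro n
    have h1 : ∏ i ∈ g n, (if P i then F i else 0 : ℝ) =
        ∏ i ∈ (n : ℕ).primeFactors with Nat.Prime i, (if P i then F i else 0 : ℝ) :=
      Finset.prod_subtype_eq_prod_filter (s := (n : ℕ).primeFactors) (p := Nat.Prime)
        (fun i => (if P i then F i else 0 : ℝ))
    rw [h1, Finset.filter_true_of_mem (fun p hp => Nat.prime_of_mem_primeFactors hp)]
    apply Finset.prod_congr rfl
    intro p hp
    rw [if_pos (n.2.2 p (Nat.prime_of_mem_primeFactors hp) (Nat.dvd_of_mem_primeFactors hp))]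
  · intro s hs
    have hP : ∀ p ∈ s, P p := by
      intro p hp
      by_contra h
      exact hs (Finset.prod_eq_zero hp (if_neg h))
    let t : Finset ℕ := s.map ⟨fun p : Nat.Primes => (p : ℕ), Subtype.val_injective⟩
    have ht : ∀ p ∈ t, ∃ h : p.Prime, (⟨p, h⟩ : Nat.Primes) ∈ s := by
      intro p hp
      obtain ⟨q, hq, rfl⟩ := Finset.mem_map.1 hp
      exact ⟨q.2, hq⟩
    have hpf : (∏ p ∈ t, p).primeFactors = t := Nat.primeFactors_prod (fun p hp => (ht p hp).1)
    refine ⟨⟨∏ p ∈ t, p, ?_, ?_⟩, ?_⟩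
    · apply Finset.squarefree_prod_of_pairwise_isCoprime
      · intro a ha b hb hab
        simp only [Function.onFun, ← Nat.coprime_iff_isRelPrime]
        exact (Nat.coprime_primes (ht a ha).1 (ht b hb).1).2 hab
      · intro a ha
        exact (ht a ha).1.prime.squarefree
    · intro p hp hd
      have h0 : (∏ p ∈ t, p) ≠ 0 := Finset.prod_ne_zero_iff.2 (fun p hp => (ht p hp).1.ne_zero)
      have : p ∈ (∏ p ∈ t, p).primeFactors := Nat.mem_primeFactors.2 ⟨hp, hd, h0⟩
      rw [hpf] at this
      exact hP _ (ht p this).2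
    · ext p
      refine Iff.trans (b := (p : ℕ) ∈ (∏ p ∈ t, p).primeFactors) Finset.mem_subtype ?_
      rw [hpf]
      constructor
      · intro h
        exact (ht _ h).2
      · intro h
        exact Finset.mem_map.2 ⟨p, h, rfl⟩

lemma aux_zf_le (f : Polynomial ℤ) (p : ℕ) (hp : p.Prime) (h : ¬ (p : ℤ) ∣ f.leadingCoeff) :
    zf f p ≤ f.natDegree := by
  have : Fact p.Prime := ⟨hp⟩
  rw [aux_zf_zmod, Nat.card_eq_fintype_card, Fintype.card_subtype]
  set g := f.map (Int.castRingHom (ZMod p)) with hg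
  have hg0 : g ≠ 0 := by
    intro h0
    apply h
    have : g.coeff f.natDegree = 0 := by rw [h0]; simp
    rw [hg, Polynomial.coeff_map] at this
    rw [← ZMod.intCast_zmod_eq_zero_iff_dvd]
    exact this
  calc _ ≤ g.roots.toFinset.card := by
        apply Finset.card_le_card
        intro x hx
        simp only [Finset.mem_filter, Finset.mem_univ, true_and] at hx
        rw [Multiset.mem_toFinset, Polynomial.mem_roots hg0, Polynomial.IsRoot.def, hg,
          Polynomial.eval_map]
        exact hx
    _ ≤ Multiset.card g.roots := Multiset.toFinset_card_le _
    _ ≤ g.natDegree := Polynomial.card_roots' _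
    _ ≤ f.natDegree := Polynomial.natDegree_map_le

lemma aux_summable (f : Polynomial ℤ) (hf : f.leadingCoeff ≠ 0) (a₁ a₂ : ℤ) (ha₁ : a₁ ≠ 0)
    (ha₂ : a₂ ≠ 0) : Summable fun p : Nat.Primes => ‖Floc f a₁ a₂ p‖ := by
  have hs : Summable fun p : Nat.Primes => (4 * (f.natDegree + 1) : ℝ) * (p : ℝ) ^ (-2 : ℝ) :=
    (Nat.Primes.summable_rpow.2 (by norm_num)).mul_left _
  refine hs.of_norm_bounded_eventually ?_
  set N : ℤ := a₁ * a₂ * f.leadingCoeff with hN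
  have hN0 : N ≠ 0 := mul_ne_zero (mul_ne_zero ha₁ ha₂) hf
  have hfin : {p : Nat.Primes | ((p : ℕ) : ℤ) ∣ N}.Finite := by
    apply Set.Finite.of_finite_image (f := fun p : Nat.Primes => (p : ℕ)) _
      (Subtype.val_injective.injOn)
    apply (Set.finite_Iic N.natAbs).subset
    rintro _ ⟨p, hp, rfl⟩
    exact Nat.le_of_dvd (Int.natAbs_pos.2 hN0) (Int.natCast_dvd.1 hp)
  refine hfin.subset ?_
  intro p hp
  by_contra hd
  apply hp
  change ¬ ((p : ℕ) : ℤ) ∣ N at hd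
  change ‖‖Floc f a₁ a₂ (p : ℕ)‖‖ ≤ (4 * (f.natDegree + 1) : ℝ) * ((p : ℕ) : ℝ) ^ (-2 : ℝ)
  have h12 : ¬ ((p : ℕ) : ℤ) ∣ a₁ * a₂ := fun h => hd (h.mul_right _)
  have h1 : ¬ ((p : ℕ) : ℤ) ∣ a₁ := fun h => h12 (h.mul_right _)
  have hl : ¬ ((p : ℕ) : ℤ) ∣ f.leadingCoeff := fun h => hd (h.mul_left _)
  have hz : (zf f p : ℝ) ≤ f.natDegree := by exact_mod_cast aux_zf_le f p p.2 hl
  have hz0 : (0 : ℝ) ≤ zf f p := by positivity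
  have h2 : (2 : ℝ) ≤ (p : ℕ) := by exact_mod_cast p.2.two_le
  rw [norm_norm, Floc, if_neg (fun h => h1 h.1), if_neg h12, norm_div, norm_pow,
    Real.norm_eq_abs, Real.norm_eq_abs, abs_of_nonneg (by linarith : (0 : ℝ) ≤ (p : ℕ) - 1),
    Real.rpow_neg (by positivity), ← div_eq_mul_inv]
  have hr : ((p : ℕ) : ℝ) ^ (2 : ℝ) = ((p : ℕ) : ℝ) ^ 2 := by norm_cast
  rw [hr, div_le_div_iff₀ (by nlinarith) (by positivity)]
  have hb : |(zf f p : ℝ) - 1| ≤ f.natDegree + 1 := by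
    rw [abs_le]; constructor <;> linarith
  have hc : ((p : ℕ) : ℝ) ^ 2 ≤ 4 * (((p : ℕ) : ℝ) - 1) ^ 2 := by nlinarith
  calc _ ≤ (f.natDegree + 1 : ℝ) * (4 * (((p : ℕ) : ℝ) - 1) ^ 2) := by gcongr
    _ = _ := by ring

lemma aux_totient (n : ℕ) (hn : Squarefree n) :
    (n.totient : ℝ) = ∏ p ∈ n.primeFactors, ((p : ℝ) - 1) := by
  have h := Nat.totient_mul_prod_primeFactors n
  rw [Nat.prod_primeFactors_of_squarefree hn, mul_comm] at h
  have h1 := Nat.eq_of_mul_eq_mul_left (Nat.pos_of_ne_zero hn.ne_zero) h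
  rw [h1]
  push_cast
  apply Finset.prod_congr rfl
  intro p hp
  rw [Nat.cast_sub (Nat.prime_of_mem_primeFactors hp).one_le]
  simp

lemma aux_moebius (n : ℕ) (hn : Squarefree n) :
    (ArithmeticFunction.moebius n : ℝ) = ∏ p ∈ n.primeFactors, (-1 : ℝ) := by
  have h := ArithmeticFunction.isMultiplicative_moebius.map_prod_of_subset_primeFactors n
    n.primeFactors subset_rfl
  rw [Nat.prod_primeFactors_of_squarefree hn] at h
  rw [h]
  push_cast
  apply Finset.prod_congr rfl
  intro p hp
  rw [ArithmeticFunction.moebius_apply_prime (Nat.prime_of_mem_primeFactors hp)]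
  simp

lemma aux_moebius_sq (n : ℕ) (hn : Squarefree n) :
    (ArithmeticFunction.moebius n : ℝ) ^ 2 = 1 := by
  rw [aux_moebius n hn, ← Finset.prod_pow]
  simp

lemma aux_coprime (P Q : ℕ → Prop) (m n : ℕ) (hm : ∀ p : ℕ, p.Prime → p ∣ m → P p)
    (hn : ∀ p : ℕ, p.Prime → p ∣ n → Q p) (h : ∀ p, P p → ¬ Q p) : m.Coprime n :=
  Nat.Coprime.symm (Nat.coprime_of_dvd (fun p hp h1 h2 => h p (hm p hp h2) (hn p hp h1)))

lemma aux_term (f : Polynomial ℤ) (a₁ a₂ : ℤ) (q m₁ m₂ : ℕ)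
    (hq : Squarefree q ∧ ∀ p : ℕ, p.Prime → p ∣ q → ¬ ((p : ℤ) ∣ a₁ * a₂))
    (hm₁ : Squarefree m₁ ∧ ∀ p : ℕ, p.Prime → p ∣ m₁ →
      ((p : ℤ) ∣ a₁ * a₂ ∧ (¬ ((p : ℤ) ∣ a₁) ∨ ¬ ((p : ℤ) ∣ a₂))))
    (hm₂ : Squarefree m₂ ∧ ∀ p : ℕ, p.Prime → p ∣ m₂ → ((p : ℤ) ∣ a₁ ∧ (p : ℤ) ∣ a₂)) :
    (((ArithmeticFunction.moebius (q : ℕ) : ℝ) ^ 2 *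
          (ArithmeticFunction.moebius (m₁ : ℕ) : ℝ) /
          ((Nat.totient (q : ℕ) : ℝ) ^ 2 * (Nat.totient (m₁ : ℕ) : ℝ)) *
        (1 / (((q : ℕ) : ℝ) * ((m₁ : ℕ) : ℝ) * ((m₂ : ℕ) : ℝ))) : ℝ) : ℂ) *
      TT f (q * m₁ * m₂) =
    (((∏ p ∈ q.primeFactors, Floc f a₁ a₂ p) * ((∏ p ∈ m₁.primeFactors, Floc f a₁ a₂ p) *
      ∏ p ∈ m₂.primeFactors, Floc f a₁ a₂ p) : ℝ) : ℂ) := by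
  have c1 : q.Coprime m₁ := aux_coprime _ _ _ _ hq.2 hm₁.2 (fun p h h' => h h'.1)
  have c2 : q.Coprime m₂ := aux_coprime _ _ _ _ hq.2 hm₂.2 (fun p h h' => h (h'.1.mul_right _))
  have c3 : m₁.Coprime m₂ := aux_coprime _ _ _ _ hm₁.2 hm₂.2 (fun p h h' => by tauto)
  have c4 : (q * m₁).Coprime m₂ := Nat.Coprime.mul_left c2 c3
  have hsq : Squarefree (q * m₁ * m₂) :=
    (Nat.squarefree_mul c4).2 ⟨(Nat.squarefree_mul c1).2 ⟨hq.1, hm₁.1⟩, hm₂.1⟩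
  have hT := aux_TT_sqf f _ hsq
  rw [c4.primeFactors_mul, Finset.prod_union c4.disjoint_primeFactors, c1.primeFactors_mul,
    Finset.prod_union c1.disjoint_primeFactors] at hT
  have e0 : ∏ p ∈ q.primeFactors, Floc f a₁ a₂ p =
      (∏ p ∈ q.primeFactors, ((zf f p : ℝ) - 1)) / (q.totient : ℝ) ^ 2 := by
    rw [aux_totient q hq.1, ← Finset.prod_pow, ← Finset.prod_div_distrib]
    apply Finset.prod_congr rfl
    intro p hp
    have := hq.2 p (Nat.prime_of_mem_primeFactors hp) (Nat.dvd_of_mem_primeFactors hp)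
    rw [Floc, if_neg (fun h => this (h.1.mul_right _)), if_neg this]
  have e1 : ∏ p ∈ m₁.primeFactors, Floc f a₁ a₂ p =
      (ArithmeticFunction.moebius m₁ : ℝ) * (∏ p ∈ m₁.primeFactors, ((zf f p : ℝ) - 1)) /
        (m₁.totient : ℝ) := by
    rw [aux_totient m₁ hm₁.1, aux_moebius m₁ hm₁.1, ← Finset.prod_mul_distrib,
      ← Finset.prod_div_distrib]
    apply Finset.prod_congr rfl
    intro p hp
    have := hm₁.2 p (Nat.prime_of_mem_primeFactors hp) (Nat.dvd_of_mem_primeFactors hp)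
    rw [Floc, if_neg (by tauto), if_pos this.1]
    ring
  have e2 : ∏ p ∈ m₂.primeFactors, Floc f a₁ a₂ p =
      ∏ p ∈ m₂.primeFactors, ((zf f p : ℝ) - 1) := by
    apply Finset.prod_congr rfl
    intro p hp
    have := hm₂.2 p (Nat.prime_of_mem_primeFactors hp) (Nat.dvd_of_mem_primeFactors hp)
    rw [Floc, if_pos this]
  rw [e0, e1, e2, aux_moebius_sq q hq.1]
  push_cast at hT ⊢
  rw [one_div, one_mul]
  rw [div_eq_mul_inv] at hT
  rw [mul_assoc, mul_comm (_⁻¹) (TT f _), hT]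
  ring

theorem stmt14 (f : Polynomial ℤ) (k : ℕ) (hk : 1 ≤ k)
    (hdeg : f.natDegree = k) (hlead : 0 < f.leadingCoeff)
    (a₁ a₂ : ℤ) (ha₁ : a₁ ≠ 0) (ha₂ : a₂ ≠ 0) :
    SS2 f a₁ a₂ = ((∏' p : Nat.Primes, (1 + Floc f a₁ a₂ (p : ℕ)) : ℝ) : ℂ) := by
  have hS := aux_summable f hlead.ne' a₁ a₂ ha₁ ha₂
  have hM : ∀ P : ℕ → Prop, Multipliable fun p : Nat.Primes =>
      (1 + if P p then Floc f a₁ a₂ p else 0 : ℝ) := by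
    intro P
    apply multipliable_one_add_of_summable
    refine hS.of_nonneg_of_le (fun _ => norm_nonneg _) (fun p => ?_)
    split_ifs <;> simp
  have M0 := hM (fun p => ¬ ((p : ℤ) ∣ a₁ * a₂))
  have M1 := hM (fun p => ((p : ℤ) ∣ a₁ * a₂ ∧ (¬ ((p : ℤ) ∣ a₁) ∨ ¬ ((p : ℤ) ∣ a₂))))
  have M2 := hM (fun p => ((p : ℤ) ∣ a₁ ∧ (p : ℤ) ∣ a₂))
  have h1 : SS2 f a₁ a₂ = (((∑' q : {n : ℕ // Squarefree n ∧ ∀ p : ℕ, p.Prime → p ∣ n →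
        ¬ ((p : ℤ) ∣ a₁ * a₂)}, ∏ p ∈ (q : ℕ).primeFactors, Floc f a₁ a₂ p) *
      ((∑' m₁ : {n : ℕ // Squarefree n ∧ ∀ p : ℕ, p.Prime → p ∣ n →
        ((p : ℤ) ∣ a₁ * a₂ ∧ (¬ ((p : ℤ) ∣ a₁) ∨ ¬ ((p : ℤ) ∣ a₂)))},
          ∏ p ∈ (m₁ : ℕ).primeFactors, Floc f a₁ a₂ p) *
      (∑' m₂ : {n : ℕ // Squarefree n ∧ ∀ p : ℕ, p.Prime → p ∣ n →
        ((p : ℤ) ∣ a₁ ∧ (p : ℤ) ∣ a₂)}, ∏ p ∈ (m₂ : ℕ).primeFactors, Floc f a₁ a₂ p)) : ℝ) : ℂ) := by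
    rw [← tsum_mul_right, Complex.ofReal_tsum]
    unfold SS2
    apply tsum_congr
    intro q
    rw [← tsum_mul_right, ← tsum_mul_left, Complex.ofReal_tsum]
    apply tsum_congr
    intro m₁
    rw [← tsum_mul_left, ← tsum_mul_left, Complex.ofReal_tsum]
    apply tsum_congr
    intro m₂
    exact aux_term f a₁ a₂ q m₁ m₂ q.2 m₁.2 m₂.2
  rw [h1, aux_tsum_prod (Floc f a₁ a₂) (fun p => ¬ ((p : ℤ) ∣ a₁ * a₂)) hS,
    aux_tsum_prod (Floc f a₁ a₂) (fun p => ((p : ℤ) ∣ a₁ * a₂ ∧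
      (¬ ((p : ℤ) ∣ a₁) ∨ ¬ ((p : ℤ) ∣ a₂)))) hS,
    aux_tsum_prod (Floc f a₁ a₂) (fun p => ((p : ℤ) ∣ a₁ ∧ (p : ℤ) ∣ a₂)) hS,
    ← M1.tprod_mul M2, ← M0.tprod_mul (M1.mul M2)]
  congr 1
  apply tprod_congr
  intro p
  by_cases b1 : ((p : ℕ) : ℤ) ∣ a₁
  · have b12 : ((p : ℕ) : ℤ) ∣ a₁ * a₂ := b1.mul_right _
    by_cases b2 : ((p : ℕ) : ℤ) ∣ a₂ <;> simp [b1, b2, b12]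
  · by_cases b12 : ((p : ℕ) : ℤ) ∣ a₁ * a₂ <;> simp [b1, b12]
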